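/- arXiv:0909.0875 — 3 statements merged into one kernel-verified Lean document; each statement's English description precedes it below -/
import Mathlib

section
/- Let M ⊂ ℝ^d be compact, let π_1,…,π_m be C¹ functions on an open set U ⊇ M, let D ⊆ M be closed, and fix indices i_1,…,i_d ∈ {1,…,m}. Let J(x) := det[∂_{x_r} π_{i_k}(x)]_{r,k=1}^d be the Jacobian determinant of (π_{i_1},…,π_{i_d}). Suppose N ∈ ℕ is such that for every t ∈ ℝ^d, card{x ∈ M : π_{i_k}(x) = t_k for k = 1,…,d, and J(x) ≠ 0} ≤ N. Then for all Lebesgue measurable sets E_1,…,E_m ⊆ ℝ, setting E := {x ∈ D : π_i(x) ∈ E_i for i = 1,…,m}, one has ∫_E |J(x)| dx ≤ N · Π_{k=1}^d |E_{i_k}|, where |E_{i_k}| denotes the Lebesgue measure of E_{i_k}. -/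
open MeasureTheory
open scoped ENNReal

/-- The Jacobian determinant `det [∂_{x_r} π_{i_k}(x)]_{r,k}` of the `d` functions
`π_{i_1},…,π_{i_d}` chosen from `π_1,…,π_m`. -/
noncomputable def jacDetOf {d m : ℕ} (π : Fin m → (Fin d → ℝ) → ℝ) (idx : Fin d → Fin m)
    (x : Fin d → ℝ) : ℝ :=
  (Matrix.of fun r k : Fin d => fderiv ℝ (π (idx k)) x (Pi.single r 1)).det

/-- A map which is strictly differentiable with invertible derivative on `s`, and whose fibers in
`s` have at most `N` points, has
the integral of the Jacobian over `s` bounded by `N` times the measure of the image of `s`. -/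
theorem lintegral_abs_det_le_mul_addHaar_image {E : Type*} [NormedAddCommGroup E]
    [NormedSpace ℝ E] [FiniteDimensional ℝ E] [MeasurableSpace E] [BorelSpace E]
    (μ : Measure E) [μ.IsAddHaarMeasure] {s : Set E} (hs : MeasurableSet s)
    {f : E → E} {f' : E → E →L[ℝ] E} (hf : ∀ x ∈ s, HasStrictFDerivAt f (f' x) x)
    (hdet : ∀ x ∈ s, (f' x).det ≠ 0) {N : ℕ} (hN : ∀ y, {x ∈ s | f x = y}.encard ≤ N) :
    ∫⁻ x in s, ENNReal.ofReal |(f' x).det| ∂μ ≤ N * μ (f '' s) := by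
  have : CompleteSpace E := FiniteDimensional.complete ℝ E
  have : ProperSpace E := FiniteDimensional.proper_real E
  rcases s.eq_empty_or_nonempty with rfl | hne
  · simp
  have hloc : ∀ x ∈ s, ∃ V : Set E, IsOpen V ∧ x ∈ V ∧ V.InjOn f := by
    intro x hx
    have h : HasStrictFDerivAt f
        ((f' x).toContinuousLinearEquivOfDetNeZero (hdet x hx) : E →L[ℝ] E) x := by
      simpa using hf x hx
    exact ⟨(h.toOpenPartialHomeomorph f).source, (h.toOpenPartialHomeomorph f).open_source,
      h.mem_toOpenPartialHomeomorph_source, (h.toOpenPartialHomeomorph f).injOn⟩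
  choose! V hVo hxV hVinj using hloc
  obtain ⟨c, hcs, hc, hcover⟩ := TopologicalSpace.countable_cover_nhdsWithin
    (fun x hx => mem_nhdsWithin_of_mem_nhds ((hVo x hx).mem_nhds (hxV x hx)))
  have hcne : c.Nonempty := by
    obtain ⟨x, hx⟩ := hne
    obtain ⟨i, hi, -⟩ := Set.mem_iUnion₂.1 (hcover hx)
    exact ⟨i, hi⟩
  obtain ⟨g, rfl⟩ := hc.exists_eq_range hcne
  have hgs : ∀ n, g n ∈ s := fun n => hcs ⟨n, rfl⟩
  set S : ℕ → Set E := fun n => s ∩ disjointed (fun n => V (g n)) n with hS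
  have hSm : ∀ n, MeasurableSet (S n) := fun n =>
    hs.inter (MeasurableSet.disjointed (fun n => (hVo _ (hgs n)).measurableSet) n)
  have hSs : ∀ n, S n ⊆ s := fun n => Set.inter_subset_left
  have hSU : ⋃ n, S n = s := by
    rw [hS, ← Set.inter_iUnion, iUnion_disjointed, Set.inter_eq_left]
    simpa using hcover
  have hSd : Pairwise (Function.onFun Disjoint S) := fun i j hij =>
    (disjoint_disjointed (fun n => V (g n)) hij).mono Set.inter_subset_right
      Set.inter_subset_right
  have hSinj : ∀ n, (S n).InjOn f := fun n => (hVinj _ (hgs n)).mono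
    (Set.inter_subset_right.trans (disjointed_subset _ n))
  have hder : ∀ n, ∀ x ∈ S n, HasFDerivWithinAt f (f' x) (S n) x := fun n x hx =>
    (hf x (hSs n hx)).hasFDerivAt.hasFDerivWithinAt
  have him : ∀ n, MeasurableSet (f '' S n) := fun n =>
    measurable_image_of_fderivWithin (hSm n) (hder n) (hSinj n)
  have himU : f '' s = ⋃ n, f '' S n := by rw [← Set.image_iUnion, hSU]
  have hcount : ∀ y, ∑' n, (f '' S n).indicator (1 : E → ℝ≥0∞) y ≤
      (f '' s).indicator (fun _ => (N : ℝ≥0∞)) y := by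
    intro y
    by_cases hy : y ∈ f '' s
    · rw [Set.indicator_of_mem hy, ENNReal.tsum_eq_iSup_sum]
      refine iSup_le fun a => ?_
      classical
      simp only [Set.indicator_apply, Pi.one_apply, Finset.sum_boole]
      have hx : ∀ n ∈ a.filter (fun n => y ∈ f '' S n), ∃ x ∈ S n, f x = y := fun n hn =>
        (Finset.mem_filter.1 hn).2
      choose! p hpS hpy using hx
      have hle : ((a.filter (fun n => y ∈ f '' S n) : Finset ℕ) : Set ℕ).encard ≤
          {x ∈ s | f x = y}.encard := by
        refine Set.encard_le_encard_of_injOn (f := p)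
          (fun n hn => ⟨hSs n (hpS n hn), hpy n hn⟩) ?_
        intro i hi j hj hij
        by_contra hne
        exact Set.disjoint_left.1 (hSd hne) (hpS i hi) (hij ▸ hpS j hj)
      rw [Set.encard_coe_eq_coe_finsetCard] at hle
      exact_mod_cast hle.trans (hN y)
    · have : ∀ n, (f '' S n).indicator (1 : E → ℝ≥0∞) y = 0 := fun n =>
        Set.indicator_of_notMem (fun h => hy (Set.image_mono (hSs n) h)) _
      simp [this]
  calc ∫⁻ x in s, ENNReal.ofReal |(f' x).det| ∂μ
      = ∑' n, ∫⁻ x in S n, ENNReal.ofReal |(f' x).det| ∂μ := by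
        rw [← lintegral_iUnion hSm hSd, hSU]
    _ = ∑' n, μ (f '' S n) := by
        simp_rw [fun n => lintegral_abs_det_fderiv_eq_addHaar_image μ (hSm n) (hder n) (hSinj n)]
    _ = ∫⁻ y, ∑' n, (f '' S n).indicator (1 : E → ℝ≥0∞) y ∂μ := by
        rw [lintegral_tsum fun n => (measurable_one.indicator (him n)).aemeasurable]
        simp_rw [fun n => lintegral_indicator_one (μ := μ) (him n)]
    _ ≤ ∫⁻ y, (f '' s).indicator (fun _ => (N : ℝ≥0∞)) y ∂μ := lintegral_mono hcount
    _ = N * μ (f '' s) := by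
        rw [lintegral_indicator_const (himU ▸ MeasurableSet.iUnion him)]

theorem det_pi_fderiv_eq_jacDetOf {d m : ℕ} (π : Fin m → (Fin d → ℝ) → ℝ) (idx : Fin d → Fin m)
    (x : Fin d → ℝ) :
    (ContinuousLinearMap.pi fun k => fderiv ℝ (π (idx k)) x).det = jacDetOf π idx x := by
  rw [ContinuousLinearMap.det, ← LinearMap.det_toMatrix', jacDetOf, ← Matrix.det_transpose]
  congr 1

theorem measurable_jacDetOf {d m : ℕ} (π : Fin m → (Fin d → ℝ) → ℝ) (idx : Fin d → Fin m) :
    Measurable (jacDetOf π idx) := by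
  unfold jacDetOf
  simp only [Matrix.det_apply, Matrix.of_apply]
  exact Finset.measurable_sum _ fun σ _ => Measurable.const_smul
    (Finset.measurable_prod _ fun k _ => measurable_fderiv_apply_const ℝ _ _) _

/-- The basic counting estimate in the proof of the main sublevel theorem:
`∫_E |J| dx ≤ N ∏_k |E_{i_k}|` when every fiber of `(π_{i_1},…,π_{i_d})` contains at most
`N` nondegenerate points of `M`. -/
theorem jacobian_integral_bound
    (d m : ℕ) (M : Set (Fin d → ℝ)) (hM : IsCompact M)
    (U : Set (Fin d → ℝ)) (hUopen : IsOpen U) (hMU : M ⊆ U)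
    (π : Fin m → (Fin d → ℝ) → ℝ) (hπ : ∀ j, ContDiffOn ℝ 1 (π j) U)
    (D : Set (Fin d → ℝ)) (hDclosed : IsClosed D) (hD : D ⊆ M)
    (idx : Fin d → Fin m) (N : ℕ)
    (hN : ∀ t : Fin d → ℝ,
      ({x ∈ M | (∀ k, π (idx k) x = t k) ∧ jacDetOf π idx x ≠ 0}.encard : ℕ∞) ≤ N)
    (E : Fin m → Set ℝ) (hE : ∀ i, MeasurableSet (E i)) :
    ∫⁻ x in {x ∈ D | ∀ i, π i x ∈ E i}, ENNReal.ofReal |jacDetOf π idx x| ≤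
      (N : ℝ≥0∞) * ∏ k : Fin d, volume (E (idx k)) := by
  set A : Set (Fin d → ℝ) := {x ∈ D | ∀ i, π i x ∈ E i} with hA
  set J := jacDetOf π idx with hJ
  set Z : Set (Fin d → ℝ) := {x | J x ≠ 0} with hZ
  have hJm : Measurable J := measurable_jacDetOf π idx
  have hZm : MeasurableSet Z := (hJm (measurableSet_singleton 0)).compl
  have hAm : MeasurableSet A := by
    have hcont : ∀ i, Measurable fun x : D => π i x := fun i =>
      ((hπ i).continuousOn.mono (hD.trans hMU)).domRestrict.measurable
    have : A = Subtype.val '' ⋂ i, (fun x : D => π i x) ⁻¹' E i := by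
      ext x
      simp [hA, and_comm]
    rw [this]
    exact hDclosed.measurableSet.subtype_image (MeasurableSet.iInter fun i => hcont i (hE i))
  have hzero : ∫⁻ x in A \ Z, ENNReal.ofReal |J x| = 0 := by
    rw [setLIntegral_congr_fun (g := fun _ => 0) (hAm.diff hZm), lintegral_zero]
    intro x hx
    have : J x = 0 := not_not.1 hx.2
    simp [this]
  rw [← lintegral_inter_add_sdiff _ A hZm, hzero, add_zero]
  have hstrict : ∀ x ∈ A ∩ Z, HasStrictFDerivAt (fun x k => π (idx k) x)
      (ContinuousLinearMap.pi fun k => fderiv ℝ (π (idx k)) x) x := fun x hx =>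
    hasStrictFDerivAt_pi.2 fun k => ((hπ (idx k)).contDiffAt
      (hUopen.mem_nhds (hMU (hD hx.1.1)))).hasStrictFDerivAt one_ne_zero
  have key := lintegral_abs_det_le_mul_addHaar_image volume (hAm.inter hZm) hstrict
    (fun x hx => (det_pi_fderiv_eq_jacDetOf π idx x).trans_ne hx.2) (N := N) fun t => by
      refine le_trans (Set.encard_le_encard ?_) (hN t)
      rintro x ⟨hx, rfl⟩
      exact ⟨hD hx.1.1, fun _ => rfl, hx.2⟩
  simp only [det_pi_fderiv_eq_jacDetOf] at key
  refine key.trans ?_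
  gcongr
  rw [← volume_pi_pi]
  refine measure_mono ?_
  rintro _ ⟨x, hx, rfl⟩ k -
  exact hx.1.2 (idx k)
end

section
/- Let M ⊂ ℝ^d be compact, let π_1,…,π_m be C¹ functions on an open set U ⊇ M, let D ⊆ M be closed, and fix indices i_1,…,i_d ∈ {1,…,m}. Let J(x) := det[∂_{x_r} π_{i_k}(x)]_{r,k=1}^d, and for i = 1,…,m let G^{(i)} := card{k ∈ {1,…,d} : i_k = i}. Suppose N ∈ ℕ is such that for every t ∈ ℝ^d, card{x ∈ M : π_{i_k}(x) = t_k for k = 1,…,d, and J(x) ≠ 0} ≤ N. Then for all Lebesgue measurable sets E_1,…,E_m ⊆ ℝ of finite measure and every δ > 0, with E := {x ∈ D : π_i(x) ∈ E_i for i = 1,…,m}, the Lebesgue measure of {x ∈ E : |J(x)| > (1/2) δ^{−1} Π_{i=1}^m |E_i|^{G^{(i)}}} is at most 2Nδ. -/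
open MeasureTheory
open scoped ENNReal

theorem ContinuousOn.measurableSet_inter_preimage {α β : Type*} [TopologicalSpace α]
    [MeasurableSpace α] [OpensMeasurableSpace α] [TopologicalSpace β] [MeasurableSpace β]
    [BorelSpace β] {f : α → β} {s : Set α} (hf : ContinuousOn f s) (hs : MeasurableSet s)
    {t : Set β} (ht : MeasurableSet t) : MeasurableSet (s ∩ f ⁻¹' t) := by
  have h := hs.subtype_image (hf.domRestrict.measurable ht)
  convert h using 1
  ext x
  simp [Set.domRestrict, and_comm]

/-- The number of pairwise disjoint sets whose image contains a point is bounded by the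
cardinality of the fiber over this point. -/
theorem tsum_indicator_image_le_of_encard_fiber_le {α β ι : Type*} {f : α → β} {s : Set α}
    {u : ι → Set α} (hu : Pairwise (Function.onFun Disjoint u)) (hus : ∀ i, u i ⊆ s) {N : ℕ}
    {y : β} (hN : {x ∈ s | f x = y}.encard ≤ N) :
    ∑' i, (f '' u i).indicator (1 : β → ℝ≥0∞) y ≤ N := by
  classical
  rw [ENNReal.tsum_eq_iSup_sum]
  refine iSup_le fun F => ?_
  have hsum : ∑ i ∈ F, (f '' u i).indicator (1 : β → ℝ≥0∞) y =
      (F.filter fun i => y ∈ f '' u i).card := by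
    simp [Set.indicator_apply]
  rw [hsum, Nat.cast_le]
  have hex : ∀ i : {i // i ∈ F.filter fun i => y ∈ f '' u i}, ∃ x ∈ u i, f x = y :=
    fun i => (Finset.mem_filter.1 i.2).2
  choose g hgu hgy using hex
  have hg : Function.Injective g := fun i j hij => by
    by_contra hne
    exact Set.disjoint_left.1 (hu fun h => hne (Subtype.ext h)) (hgu i) (hij ▸ hgu j)
  have hcard : (Set.range g).encard ≤ N :=
    (Set.encard_le_encard (t := {x ∈ s | f x = y})
      (Set.range_subset_iff.2 fun i => ⟨hus _ (hgu i), hgy i⟩)).trans hN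
  rw [← Set.image_univ, hg.encard_image, Set.encard_univ, ENat.card_eq_coe_fintype_card,
    Fintype.card_coe] at hcard
  exact_mod_cast hcard

section Area

variable {V : Type*} [NormedAddCommGroup V] [NormedSpace ℝ V] [FiniteDimensional ℝ V]
  {f : V → V} {f' : V → V →L[ℝ] V} {s : Set V}

/-- A function with invertible derivative on a set is injective on each piece of a countable
measurable partition of this set. -/
theorem exists_partition_injOn_of_hasFDerivWithinAt [MeasurableSpace V] [BorelSpace V]
    (hf' : ∀ x ∈ s, HasFDerivWithinAt f (f' x) s x) (hdet : ∀ x ∈ s, (f' x).det ≠ 0) :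
    ∃ t : ℕ → Set V, Pairwise (Function.onFun Disjoint t) ∧ (∀ n, MeasurableSet (t n)) ∧
      s ⊆ ⋃ n, t n ∧ ∀ n, Set.InjOn f (s ∩ t n) := by
  classical
  have hr : ∀ A : V →L[ℝ] V, ∃ r : NNReal, r ≠ 0 ∧ (A.det ≠ 0 → ∀ u : Set V,
      ApproximatesLinearOn f A u r → Set.InjOn f u) := fun A => by
    by_cases hA : A.det = 0
    · exact ⟨1, one_ne_zero, fun h => absurd hA h⟩
    · have hB := A.coe_toContinuousLinearEquivOfDetNeZero hA
      set B := A.toContinuousLinearEquivOfDetNeZero hA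
      rcases subsingleton_or_nontrivial V with hV | hV
      · exact ⟨1, one_ne_zero, fun _ u _ => Set.injOn_of_injective
          (Function.injective_of_subsingleton f)⟩
      · have hpos : 0 < ‖(B.symm : V →L[ℝ] V)‖₊⁻¹ := inv_pos.2 B.nnnorm_symm_pos
        refine ⟨‖(B.symm : V →L[ℝ] V)‖₊⁻¹ / 2, (half_pos hpos).ne', fun _ u hu => ?_⟩
        rw [← hB] at hu
        exact hu.injOn (Or.inr (half_lt_self hpos))
  choose r hr0 hr using hr
  obtain ⟨t, A, htd, htm, hst, hta, hA⟩ :=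
    exists_partition_approximatesLinearOn_of_hasFDerivWithinAt f s f' hf' r hr0
  refine ⟨t, htd, htm, hst, fun n => ?_⟩
  rcases s.eq_empty_or_nonempty with rfl | hs
  · simp
  · obtain ⟨y, hy, hAy⟩ := hA hs n
    exact hr (A n) (hAy ▸ hdet y hy) _ (hta n)

/-- Area inequality: if the fibers of `f` on `s` have at most `N` points, then the integral over
`s` of the (nonvanishing) Jacobian is at most `N` times the measure of any set containing the
image. -/
theorem lintegral_abs_det_fderiv_le_of_encard_fiber_le [MeasurableSpace V] [BorelSpace V]
    (μ : Measure V) [μ.IsAddHaarMeasure] (hs : MeasurableSet s)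
    (hf' : ∀ x ∈ s, HasFDerivWithinAt f (f' x) s x) (hdet : ∀ x ∈ s, (f' x).det ≠ 0)
    {T : Set V} (hT : Set.MapsTo f s T) {N : ℕ} (hN : ∀ y, {x ∈ s | f x = y}.encard ≤ N) :
    ∫⁻ x in s, ENNReal.ofReal |(f' x).det| ∂μ ≤ N * μ T := by
  obtain ⟨t, htd, htm, hst, hinj⟩ := exists_partition_injOn_of_hasFDerivWithinAt hf' hdet
  have hd : Pairwise (Function.onFun Disjoint fun n => s ∩ t n) := fun i j hij =>
    (htd hij).mono Set.inter_subset_right Set.inter_subset_right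
  have hm : ∀ n, MeasurableSet (s ∩ t n) := fun n => hs.inter (htm n)
  have hder : ∀ n, ∀ x ∈ s ∩ t n, HasFDerivWithinAt f (f' x) (s ∩ t n) x := fun n x hx =>
    (hf' x hx.1).mono Set.inter_subset_left
  have him : ∀ n, MeasurableSet (f '' (s ∩ t n)) := fun n =>
    measurable_image_of_fderivWithin (hm n) (hder n) (hinj n)
  have hsub : ∀ n, f '' (s ∩ t n) ⊆ toMeasurable μ T := fun n =>
    ((hT.mono_left Set.inter_subset_left).image_subset).trans (subset_toMeasurable μ T)
  calc ∫⁻ x in s, ENNReal.ofReal |(f' x).det| ∂μ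
      = ∫⁻ x in ⋃ n, s ∩ t n, ENNReal.ofReal |(f' x).det| ∂μ := by
        rw [← Set.inter_iUnion, Set.inter_eq_self_of_subset_left hst]
    _ = ∑' n, μ (f '' (s ∩ t n)) := by
        rw [lintegral_iUnion hm hd]
        exact tsum_congr fun n =>
          lintegral_abs_det_fderiv_eq_addHaar_image μ (hm n) (hder n) (hinj n)
    _ = ∑' n, ∫⁻ y in toMeasurable μ T, (f '' (s ∩ t n)).indicator 1 y ∂μ := by
        refine tsum_congr fun n => ?_
        rw [lintegral_indicator_one (him n), Measure.restrict_apply (him n),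
          Set.inter_eq_self_of_subset_left (hsub n)]
    _ = ∫⁻ y in toMeasurable μ T, ∑' n, (f '' (s ∩ t n)).indicator 1 y ∂μ :=
        (lintegral_tsum fun n => (measurable_one.indicator (him n)).aemeasurable).symm
    _ ≤ ∫⁻ _ in toMeasurable μ T, N ∂μ := lintegral_mono fun y =>
        tsum_indicator_image_le_of_encard_fiber_le hd (fun _ => Set.inter_subset_left) (hN y)
    _ = N * μ T := by rw [setLIntegral_const, measure_toMeasurable]

end Area

theorem continuousOn_jacDetOf {d m : ℕ} {π : Fin m → (Fin d → ℝ) → ℝ} {U : Set (Fin d → ℝ)}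
    (hU : IsOpen U) (hπ : ∀ j, ContDiffOn ℝ 1 (π j) U) (idx : Fin d → Fin m) :
    ContinuousOn (jacDetOf π idx) U := by
  rw [continuousOn_iff_continuous_domRestrict]
  refine Continuous.matrix_det (continuous_matrix fun r k => ?_)
  exact continuousOn_iff_continuous_domRestrict.1
    (((hπ (idx k)).continuousOn_fderiv_of_isOpen hU le_rfl).clm_apply continuousOn_const)

/-- The localization step in the proof of the main sublevel theorem: the portion of `E`
where `|J| > (1/2) δ⁻¹ ∏_i |E_i|^{G^{(i)}}` has measure at most `2Nδ`.  Here
`G^{(i)} = #{k : i_k = i}`. -/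
theorem jacobian_localization_bound
    (d m : ℕ) (M : Set (Fin d → ℝ)) (hM : IsCompact M)
    (U : Set (Fin d → ℝ)) (hUopen : IsOpen U) (hMU : M ⊆ U)
    (π : Fin m → (Fin d → ℝ) → ℝ) (hπ : ∀ j, ContDiffOn ℝ 1 (π j) U)
    (D : Set (Fin d → ℝ)) (hDclosed : IsClosed D) (hD : D ⊆ M)
    (idx : Fin d → Fin m) (N : ℕ)
    (hN : ∀ t : Fin d → ℝ,
      ({x ∈ M | (∀ k, π (idx k) x = t k) ∧ jacDetOf π idx x ≠ 0}.encard : ℕ∞) ≤ N)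
    (E : Fin m → Set ℝ) (hE : ∀ i, MeasurableSet (E i)) (hEfin : ∀ i, volume (E i) ≠ ⊤)
    (δ : ℝ) (hδ : 0 < δ) :
    volume {x ∈ {x ∈ D | ∀ i, π i x ∈ E i} |
        (1 / 2) * δ⁻¹ *
            ∏ i : Fin m, (volume (E i)).toReal ^
              (Finset.univ.filter fun k : Fin d => idx k = i).card
          < |jacDetOf π idx x|} ≤
      ENNReal.ofReal (2 * N * δ) := by
  set P : ℝ := ∏ i : Fin m, (volume (E i)).toReal ^
    (Finset.univ.filter fun k : Fin d => idx k = i).card with hP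
  set A : Set (Fin d → ℝ) := {x ∈ {x ∈ D | ∀ i, π i x ∈ E i} |
    (1 / 2) * δ⁻¹ * P < |jacDetOf π idx x|} with hA
  have hP0 : 0 ≤ P := by positivity
  have hAU : A ⊆ U := fun x hx => hMU (hD hx.1.1)
  have hJ : ∀ x ∈ A, jacDetOf π idx x ≠ 0 := fun x hx =>
    abs_pos.1 (lt_of_le_of_lt (by positivity) hx.2)
  have hAm : MeasurableSet A := by
    have hDU : D ⊆ U := hD.trans hMU
    have hcont : ContinuousOn (fun x => ((fun i => π i x), jacDetOf π idx x)) D :=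
      (continuousOn_pi.2 fun i => (hπ i).continuousOn.mono hDU).prodMk
        ((continuousOn_jacDetOf hUopen hπ idx).mono hDU)
    have hmeas : MeasurableSet ((Set.univ.pi E) ×ˢ {y : ℝ | (1 / 2) * δ⁻¹ * P < |y|}) :=
      (MeasurableSet.univ_pi hE).prod (measurableSet_lt measurable_const measurable_norm)
    convert hcont.measurableSet_inter_preimage hDclosed.measurableSet hmeas using 1
    ext x
    simp only [hA, Set.mem_ofPred_eq, Set.mem_inter_iff, Set.mem_preimage, Set.mem_prod,
      Set.mem_univ_pi, and_assoc]
  set F' : (Fin d → ℝ) → (Fin d → ℝ) →L[ℝ] (Fin d → ℝ) := fun x =>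
    ContinuousLinearMap.pi fun k => fderiv ℝ (π (idx k)) x with hF'
  have hdet : ∀ x, (F' x).det = jacDetOf π idx x := det_pi_fderiv_eq_jacDetOf π idx
  have hder : ∀ x ∈ A, HasFDerivWithinAt (fun x k => π (idx k) x) (F' x) A x := fun x hx =>
    (hasFDerivAt_pi.2 fun k => (((hπ (idx k)).contDiffAt
      (hUopen.mem_nhds (hAU hx))).differentiableAt one_ne_zero).hasFDerivAt).hasFDerivWithinAt
  have hvol : volume (Set.univ.pi fun k => E (idx k)) = ENNReal.ofReal P := by
    rw [volume_pi_pi, hP, ENNReal.ofReal_prod_of_nonneg fun i _ => by positivity,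
      ← Finset.prod_fiberwise' Finset.univ idx fun i => volume (E i)]
    refine Finset.prod_congr rfl fun i _ => ?_
    rw [Finset.prod_const, ENNReal.ofReal_pow ENNReal.toReal_nonneg,
      ENNReal.ofReal_toReal (hEfin i)]
  have hint : ∫⁻ x in A, ENNReal.ofReal |(F' x).det| ≤ N * ENNReal.ofReal P := by
    rw [← hvol]
    refine lintegral_abs_det_fderiv_le_of_encard_fiber_le volume hAm hder
      (T := Set.univ.pi fun k => E (idx k)) (fun x hx => (hdet x).trans_ne (hJ x hx))
      (fun x hx k _ => hx.1.2 (idx k)) fun y => ?_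
    refine (Set.encard_le_encard fun x hx => ?_).trans (hN y)
    exact ⟨hD hx.1.1.1, fun k => congrFun hx.2 k, hJ x hx.1⟩
  rcases hP0.eq_or_lt with hPz | hPpos
  · rw [← hPz, ENNReal.ofReal_zero, mul_zero, nonpos_iff_eq_zero, lintegral_eq_zero_iff'
      (aemeasurable_ofReal_abs_det_fderivWithin volume hAm hder)] at hint
    have hfalse : ∀ᵐ x ∂volume.restrict A, False := by
      filter_upwards [hint, ae_restrict_mem hAm] with x hx hxA
      rw [Pi.zero_apply, ENNReal.ofReal_eq_zero, hdet] at hx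
      exact hJ x hxA (abs_nonpos_iff.1 hx)
    have hzero : volume A = 0 := by simpa [Filter.eventually_false_iff_eq_bot] using hfalse
    rw [hzero]
    exact zero_le
  · have hc : 0 < (1 / 2) * δ⁻¹ * P := by positivity
    have hle : ENNReal.ofReal ((1 / 2) * δ⁻¹ * P) * volume A ≤
        ENNReal.ofReal ((1 / 2) * δ⁻¹ * P) * ENNReal.ofReal (2 * N * δ) := by
      calc ENNReal.ofReal ((1 / 2) * δ⁻¹ * P) * volume A
          = ∫⁻ _ in A, ENNReal.ofReal ((1 / 2) * δ⁻¹ * P) := (setLIntegral_const _ _).symm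
        _ ≤ ∫⁻ x in A, ENNReal.ofReal |(F' x).det| := setLIntegral_mono' hAm fun x hx =>
            ENNReal.ofReal_le_ofReal (by rw [hdet]; exact hx.2.le)
        _ ≤ N * ENNReal.ofReal P := hint
        _ = ENNReal.ofReal ((1 / 2) * δ⁻¹ * P) * ENNReal.ofReal (2 * N * δ) := by
            rw [← ENNReal.ofReal_mul hc.le, ← ENNReal.ofReal_natCast,
              ← ENNReal.ofReal_mul N.cast_nonneg]
            congr 1
            field_simp
    exact (ENNReal.mul_le_mul_iff_right (ENNReal.ofReal_pos.2 hc).ne' ENNReal.ofReal_ne_top).1 hle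
end

section
/- Let M ⊂ ℝ^d be compact and let π_1,…,π_m be real-analytic on an open set U ⊇ M. Fix K, N ∈ ℕ. Then there exists a finite constant C, depending only on K, N, m, and d, such that for all Lebesgue measurable sets E_1,…,E_m ⊆ ℝ of finite measure, every closed D ⊆ M, and every δ > 0, the set E := {x ∈ D : π_i(x) ∈ E_i for i = 1,…,m} satisfies |E| ≤ Cδ + |E ∩ ⋂_{G ∈ 𝒢_K^N(M,π)} {x ∈ M : |∂^Gπ(x)| ≤ δ^{−#G} Π_{j=1}^m |E_j|^{G^{(j)}}}|, where |·| denotes Lebesgue measure. -/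
open MeasureTheory
open scoped ENNReal

/-- A `d`-tree on `m` indices: an element of `⋃ K, 𝒢_K` where `𝒢_0 = {1,…,m}` and
`𝒢_K = 𝒢_{K-1} ∪ (𝒢_{K-1})^d`. -/
inductive DTree (d m : ℕ) : Type
  | leaf : Fin m → DTree d m
  | node : (Fin d → DTree d m) → DTree d m

namespace DTree
variable {d m : ℕ}

/-- `#G`: `0` for a trivial tree, `#G_1 + ⋯ + #G_d + 1` for `G = (G_1,…,G_d)`. -/
noncomputable def count : DTree d m → ℕ :=
  DTree.rec (motive := fun _ => ℕ) (fun _ => 0) (fun _ ih => (∑ k, ih k) + 1)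

/-- `G^{(j)}`: the number of leaves of `G` carrying the index `j`. -/
noncomputable def mult (j : Fin m) : DTree d m → ℕ :=
  DTree.rec (motive := fun _ => ℕ) (fun i => if i = j then 1 else 0) (fun _ ih => ∑ k, ih k)

/-- The depth of a `d`-tree; `G ∈ 𝒢_K` if and only if `G.depth ≤ K`. -/
noncomputable def depth : DTree d m → ℕ :=
  DTree.rec (motive := fun _ => ℕ) (fun _ => 0) (fun _ ih => (Finset.univ.sup ih) + 1)

/-- The derived function `∂^G π`: `π_i` for the trivial tree `i`, and the Jacobian
determinant `det [∂_{x_r} (∂^{G_k} π)]` for `G = (G_1,…,G_d)`. -/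
noncomputable def deriv (π : Fin m → (Fin d → ℝ) → ℝ) : DTree d m → (Fin d → ℝ) → ℝ :=
  DTree.rec (motive := fun _ => (Fin d → ℝ) → ℝ) (fun i => π i)
    (fun _ ih x => (Matrix.of fun r k : Fin d => fderiv ℝ (ih k) x (Pi.single r 1)).det)

/-- A `d`-tree is nontrivial when it is not a single leaf. -/
def Nontrivial (G : DTree d m) : Prop := ∀ i, G ≠ DTree.leaf i

end DTree

/-- The strong multiplicity `N` condition on `M` for a `d`-tree `G`: trivial trees satisfy
it, and `G = (G_1,…,G_d)` satisfies it when each `G_k` does and moreover for every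
`c ∈ ℝ^d` the system `∂^{G_k}π(x) = c_k` has at most `N` nondegenerate solutions `x ∈ M`
(nondegenerate meaning `∂^Gπ(x) ≠ 0`). -/
noncomputable def DTree.StrongMult {d m : ℕ} (M : Set (Fin d → ℝ))
    (π : Fin m → (Fin d → ℝ) → ℝ) (N : ℕ) : DTree d m → Prop :=
  DTree.rec (motive := fun _ => Prop) (fun _ => True)
    (fun Gs ih => (∀ k, ih k) ∧ ∀ c : Fin d → ℝ,
      ({x ∈ M | (∀ k, (Gs k).deriv π x = c k) ∧
          (DTree.node Gs).deriv π x ≠ 0}.encard : ℕ∞) ≤ N)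

/-- A measurable partition adapted to local injectivity: near every point of `s` the map `f` is
invertible, so `s` is a countable disjoint union of measurable sets on which `f` is injective. -/
theorem exists_measurable_partition_injOn {E : Type*} [NormedAddCommGroup E] [NormedSpace ℝ E]
    [FiniteDimensional ℝ E] [MeasurableSpace E] [BorelSpace E]
    {f : E → E} {f' : E → E →L[ℝ] E} {s : Set E} (hs : MeasurableSet s)
    (hf : ∀ x ∈ s, HasStrictFDerivAt f (f' x) x) (hdet : ∀ x ∈ s, (f' x).det ≠ 0) :
    ∃ t : ℕ → Set E, (∀ n, MeasurableSet (t n)) ∧ Pairwise (Function.onFun Disjoint t) ∧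
      (∀ n, Set.InjOn f (t n)) ∧ s = ⋃ n, t n := by
  have : CompleteSpace E := FiniteDimensional.complete ℝ E
  have : ProperSpace E := FiniteDimensional.proper ℝ E
  have hloc : ∀ x, ∃ V : Set E, IsOpen V ∧ (x ∈ s → x ∈ V) ∧ Set.InjOn f V := by
    intro x
    by_cases hx : x ∈ s
    · have h : HasStrictFDerivAt f
          ((f' x).toContinuousLinearEquivOfDetNeZero (hdet x hx) : E →L[ℝ] E) x := by
        simpa using hf x hx
      refine ⟨(h.toOpenPartialHomeomorph f).source, (h.toOpenPartialHomeomorph f).open_source,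
        fun _ => h.mem_toOpenPartialHomeomorph_source, ?_⟩
      simpa using (h.toOpenPartialHomeomorph f).injOn
    · exact ⟨∅, isOpen_empty, fun h => absurd h hx, Set.injOn_empty f⟩
  choose V hVo hxV hVinj using hloc
  obtain ⟨c, -, hc, hsc⟩ := TopologicalSpace.countable_cover_nhdsWithin (s := s) (f := V)
    fun x hx => mem_nhdsWithin_of_mem_nhds ((hVo x).mem_nhds (hxV x hx))
  rcases c.eq_empty_or_nonempty with rfl | hne
  · refine ⟨fun _ => ∅, by simp, fun _ _ _ => by simp [Function.onFun], by simp, ?_⟩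
    simpa [Set.subset_empty_iff] using hsc
  obtain ⟨u, rfl⟩ := hc.exists_eq_range hne
  have hsub : ∀ n, disjointed (fun n => s ∩ V (u n)) n ⊆ s ∩ V (u n) :=
    fun n => disjointed_subset (fun n => s ∩ V (u n)) n
  refine ⟨disjointed fun n => s ∩ V (u n),
    fun n => MeasurableSet.disjointed (fun n => hs.inter (hVo (u n)).measurableSet) n,
    disjoint_disjointed _, fun n => (hVinj (u n)).mono fun x hx => (hsub n hx).2, ?_⟩
  rw [iUnion_disjointed, ← Set.inter_iUnion]
  refine (Set.inter_eq_left.2 ?_).symm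
  simpa using hsc

/-- Change of variables inequality for a map whose fibres have at most `N` points. -/
theorem lintegral_abs_det_le_of_encard_fiber_le {E : Type*} [NormedAddCommGroup E]
    [NormedSpace ℝ E] [FiniteDimensional ℝ E] [MeasurableSpace E] [BorelSpace E]
    (μ : Measure E) [μ.IsAddHaarMeasure]
    {f : E → E} {f' : E → E →L[ℝ] E} {s : Set E} (hs : MeasurableSet s)
    (hf : ∀ x ∈ s, HasStrictFDerivAt f (f' x) x) (hdet : ∀ x ∈ s, (f' x).det ≠ 0) {N : ℕ}
    (hN : ∀ y, {x ∈ s | f x = y}.encard ≤ N) :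
    ∫⁻ x in s, ENNReal.ofReal |(f' x).det| ∂μ ≤ N * μ (f '' s) := by
  obtain ⟨t, htm, htd, hti, rfl⟩ := exists_measurable_partition_injOn hs hf hdet
  have hfd : ∀ n, ∀ x ∈ t n, HasFDerivWithinAt f (f' x) (t n) x := fun n x hx =>
    (hf x (Set.mem_iUnion_of_mem n hx)).hasFDerivAt.hasFDerivWithinAt
  have him : ∀ n, MeasurableSet (f '' t n) := fun n =>
    measurable_image_of_fderivWithin (htm n) (hfd n) (hti n)
  have himU : MeasurableSet (f '' ⋃ n, t n) := by
    rw [Set.image_iUnion]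
    exact .iUnion him
  rw [lintegral_iUnion htm htd]
  have hcard : ∀ y, ∑' n, (f '' t n).indicator (1 : E → ℝ≥0∞) y ≤
      (f '' ⋃ n, t n).indicator (fun _ => (N : ℝ≥0∞)) y := by
    classical
    intro y
    by_cases hy : y ∈ f '' ⋃ n, t n
    · rw [Set.indicator_of_mem hy, ENNReal.tsum_eq_iSup_sum]
      refine iSup_le fun F => ?_
      have hmem : ∀ n : {n ∈ F | y ∈ f '' t n}, ∃ x ∈ t n, f x = y := fun n =>
        (Finset.mem_filter.1 n.2).2
      choose x hxt hxy using hmem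
      have hinj : Function.Injective x := by
        intro a b hab
        by_contra hne
        exact Set.disjoint_left.1 (htd fun h => hne (Subtype.ext h)) (hxt a) (hab ▸ hxt b)
      have hle : (Set.range x).encard ≤ N := by
        refine (Set.encard_le_encard ?_).trans (hN y)
        rintro _ ⟨n, rfl⟩
        exact ⟨Set.mem_iUnion_of_mem _ (hxt n), hxy n⟩
      replace hle := hinj.encard_range.trans hle
      rw [ENat.card_eq_coe_fintype_card, Fintype.card_coe] at hle
      simp only [Set.indicator_apply, Pi.one_apply, Finset.sum_boole]
      exact_mod_cast hle
    · have : ∀ n, y ∉ f '' t n := fun n h =>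
        hy (Set.image_mono (Set.subset_iUnion t n) h)
      simp [Set.indicator_of_notMem hy, Set.indicator_of_notMem (this _)]
  calc ∑' n, ∫⁻ x in t n, ENNReal.ofReal |(f' x).det| ∂μ
      = ∑' n, ∫⁻ y, (f '' t n).indicator 1 y ∂μ := by
        refine tsum_congr fun n => ?_
        rw [lintegral_abs_det_fderiv_eq_addHaar_image μ (htm n) (hfd n) (hti n),
          lintegral_indicator_one (him n)]
    _ = ∫⁻ y, ∑' n, (f '' t n).indicator 1 y ∂μ :=
        (lintegral_tsum fun n => (measurable_one.indicator (him n)).aemeasurable).symm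
    _ ≤ ∫⁻ y, (f '' ⋃ n, t n).indicator (fun _ => (N : ℝ≥0∞)) y ∂μ := lintegral_mono hcard
    _ = N * μ (f '' ⋃ n, t n) := lintegral_indicator_const himU _

/-- If `f` maps `s` into a set of measure at most `N⁻¹ b δ` with fibres of at most `N` points, and
its Jacobian determinant exceeds `b` on `s`, then `s` has measure at most `δ`. -/
theorem measure_le_of_lt_abs_det {E : Type*} [NormedAddCommGroup E]
    [NormedSpace ℝ E] [FiniteDimensional ℝ E] [MeasurableSpace E] [BorelSpace E]
    (μ : Measure E) [μ.IsAddHaarMeasure]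
    {f : E → E} {f' : E → E →L[ℝ] E} {s : Set E} (hs : MeasurableSet s)
    (hf : ∀ x ∈ s, HasStrictFDerivAt f (f' x) x)
    (hcont : ContinuousOn (fun x => (f' x).det) s) {N : ℕ}
    (hN : ∀ y, {x ∈ s | f x = y}.encard ≤ N) {b δ : ℝ} (hb : 0 ≤ b)
    (hbs : ∀ x ∈ s, b < |(f' x).det|)
    (hvol : N * μ (f '' s) ≤ ENNReal.ofReal (b * δ)) :
    μ s ≤ ENNReal.ofReal δ := by
  have hint := (lintegral_abs_det_le_of_encard_fiber_le μ hs hf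
    (fun x hx => abs_pos.1 (hb.trans_lt (hbs x hx))) hN).trans hvol
  rcases hb.eq_or_lt with rfl | hb
  · have hmeas : AEMeasurable (fun x => ENNReal.ofReal |(f' x).det|) (μ.restrict s) :=
      ENNReal.measurable_ofReal.comp_aemeasurable (hcont.abs.aemeasurable hs)
    have h0 := (lintegral_eq_zero_iff' hmeas).1 (by simpa using hint)
    have : μ s = 0 := by
      rw [Filter.EventuallyEq, ae_restrict_iff' hs] at h0
      rw [measure_eq_zero_iff_ae_notMem]
      filter_upwards [h0] with x h hx
      have := h hx
      simp only [Pi.zero_apply, ENNReal.ofReal_eq_zero] at this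
      exact (hbs x hx).not_ge this
    simp [this]
  · have h1 : ENNReal.ofReal b * μ s ≤ ENNReal.ofReal b * ENNReal.ofReal δ := by
      rw [← ENNReal.ofReal_mul hb.le, ← setLIntegral_const]
      exact (setLIntegral_mono' hs fun x hx => ENNReal.ofReal_le_ofReal (hbs x hx).le).trans hint
    exact (ENNReal.mul_le_mul_iff_right (by simpa using hb) ENNReal.ofReal_ne_top).1 h1

namespace DTree
variable {d m : ℕ}

theorem finite_setOf_depth_le (K : ℕ) : {G : DTree d m | G.depth ≤ K}.Finite := by
  induction K with
  | zero =>
    refine (Set.finite_range leaf).subset ?_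
    rintro (i | Gs) h
    · exact ⟨i, rfl⟩
    · exact absurd h (Nat.not_succ_le_zero _)
  | succ K ih =>
    refine ((Set.finite_range leaf).union
      ((Set.Finite.pi' fun _ : Fin d => ih).image node)).subset ?_
    rintro (i | Gs) h
    · exact Or.inl ⟨i, rfl⟩
    · refine Or.inr ⟨Gs, fun k => ?_, rfl⟩
      exact (Finset.le_sup (f := fun k => (Gs k).depth) (Finset.mem_univ k)).trans
        (Nat.succ_le_succ_iff.1 h)

theorem finite_setOf_depth_node_le (K : ℕ) :
    {Gs : Fin d → DTree d m | (node Gs).depth ≤ K}.Finite :=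
  (finite_setOf_depth_le K).preimage fun _ _ _ _ h => node.inj h

theorem depth_child_le (Gs : Fin d → DTree d m) (k : Fin d) :
    (Gs k).depth ≤ (node Gs).depth :=
  (Finset.le_sup (f := fun k => (Gs k).depth) (Finset.mem_univ k)).trans (Nat.le_succ _)

theorem analyticOnNhd_deriv {π : Fin m → (Fin d → ℝ) → ℝ} {U : Set (Fin d → ℝ)}
    (hπ : ∀ j, AnalyticOnNhd ℝ (π j) U) (G : DTree d m) : AnalyticOnNhd ℝ (G.deriv π) U := by
  induction G with
  | leaf i => exact hπ i
  | node Gs ih =>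
    have h : (node Gs).deriv π = fun x => ∑ σ : Equiv.Perm (Fin d), ((σ.sign : ℤ) : ℝ) *
        ∏ i, fderiv ℝ ((Gs i).deriv π) x (Pi.single (σ i) 1) :=
      funext fun x => Matrix.det_apply' _
    rw [h]
    refine Finset.analyticOnNhd_fun_sum _ fun σ _ => analyticOnNhd_const.mul
      (Finset.analyticOnNhd_fun_prod _ fun i _ => ?_)
    exact (ContinuousLinearMap.apply ℝ ℝ (Pi.single (σ i) (1 : ℝ))).comp_analyticOnNhd (ih i).fderiv

/-- The map `(∂^{G_1}π, …, ∂^{G_d}π)` has the Jacobian determinant `∂^{(G_1,…,G_d)}π`. -/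
theorem det_pi_fderiv (π : Fin m → (Fin d → ℝ) → ℝ) (Gs : Fin d → DTree d m) (x : Fin d → ℝ) :
    (ContinuousLinearMap.pi fun k => fderiv ℝ ((Gs k).deriv π) x).det = (node Gs).deriv π x := by
  rw [ContinuousLinearMap.det, ← LinearMap.det_toMatrix', ← Matrix.det_transpose]
  rfl

/-- The bound `δ^{-#G} ∏_j e_j^{G^{(j)}}`. -/
noncomputable def bound (δ : ℝ) (e : Fin m → ℝ) (G : DTree d m) : ℝ :=
  δ ^ (-(G.count : ℤ)) * ∏ j, e j ^ G.mult j

theorem bound_nonneg {δ : ℝ} (hδ : 0 < δ) {e : Fin m → ℝ} (he : ∀ j, 0 ≤ e j) (G : DTree d m) :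
    0 ≤ G.bound δ e :=
  mul_nonneg (zpow_nonneg hδ.le _) (Finset.prod_nonneg fun j _ => pow_nonneg (he j) _)

theorem bound_leaf (δ : ℝ) (e : Fin m → ℝ) (i : Fin m) : (leaf i : DTree d m).bound δ e = e i := by
  have h : ∀ j, e j ^ (leaf i : DTree d m).mult j = if i = j then e j else 1 := by
    intro j
    change e j ^ (if i = j then 1 else 0) = _
    split_ifs <;> simp
  have hc : (leaf i : DTree d m).count = 0 := rfl
  simp [bound, h, hc]

theorem bound_node_mul {δ : ℝ} (hδ : 0 < δ) (e : Fin m → ℝ) (Gs : Fin d → DTree d m) :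
    (node Gs).bound δ e * δ = ∏ k, (Gs k).bound δ e := by
  have hc : (node Gs).count = (∑ k, (Gs k).count) + 1 := rfl
  have hm : ∀ j, (node Gs).mult j = ∑ k, (Gs k).mult j := fun j => rfl
  simp only [bound, hc, hm, Finset.prod_mul_distrib, zpow_neg, zpow_natCast, Finset.prod_inv_distrib,
    ← Finset.prod_pow_eq_pow_sum]
  rw [Finset.prod_comm, Finset.prod_pow_eq_pow_sum, pow_succ]
  field_simp

/-- The range of values of `∂^Gπ` that are not exceptional: `E i` for the trivial tree `i`, and the
interval cut out by `bound` for a nontrivial tree. -/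
def target (δ : ℝ) (e : Fin m → ℝ) (E : Fin m → Set ℝ) : DTree d m → Set ℝ
  | leaf i => E i
  | node Gs => Set.Icc (-(node Gs).bound δ e) ((node Gs).bound δ e)

theorem measurableSet_target (δ : ℝ) (e : Fin m → ℝ) {E : Fin m → Set ℝ}
    (hE : ∀ i, MeasurableSet (E i)) (G : DTree d m) : MeasurableSet (G.target δ e E) := by
  cases G with
  | leaf i => exact hE i
  | node Gs => exact measurableSet_Icc

theorem volume_target_le (δ : ℝ) {E : Fin m → Set ℝ}
    (hE : ∀ i, volume (E i) ≠ ⊤) (G : DTree d m) :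
    volume (G.target δ (fun j => (volume (E j)).toReal) E) ≤
      ENNReal.ofReal (2 * G.bound δ fun j => (volume (E j)).toReal) := by
  cases G with
  | leaf i =>
    rw [bound_leaf]
    change volume (E i) ≤ _
    refine (ENNReal.ofReal_toReal (hE i)).symm.le.trans (ENNReal.ofReal_le_ofReal ?_)
    linarith [ENNReal.toReal_nonneg (a := volume (E i))]
  | node Gs =>
    rw [target, Real.volume_Icc]
    exact (congrArg ENNReal.ofReal (by ring)).le

/-- The points of `D` where `(node Gs).deriv π` is too large although the derived functions of all
children take values in their target sets. -/
def exceptional (D : Set (Fin d → ℝ)) (π : Fin m → (Fin d → ℝ) → ℝ) (δ : ℝ) (E : Fin m → Set ℝ)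
    (Gs : Fin d → DTree d m) : Set (Fin d → ℝ) :=
  {x ∈ D | (∀ k, (Gs k).deriv π x ∈ (Gs k).target δ (fun j => (volume (E j)).toReal) E) ∧
    (node Gs).bound δ (fun j => (volume (E j)).toReal) < |(node Gs).deriv π x|}

theorem measurableSet_exceptional {D : Set (Fin d → ℝ)} (hD : MeasurableSet D)
    {π : Fin m → (Fin d → ℝ) → ℝ} (hπ : ∀ G : DTree d m, ContinuousOn (G.deriv π) D) (δ : ℝ)
    {E : Fin m → Set ℝ} (hE : ∀ i, MeasurableSet (E i)) (Gs : Fin d → DTree d m) :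
    MeasurableSet (exceptional D π δ E Gs) := by
  have hmeas : ∀ G : DTree d m, Measurable fun x : D => G.deriv π x := fun G =>
    (hπ G).domRestrict.measurable
  have h : exceptional D π δ E Gs = Subtype.val '' ((⋂ k, (fun x : D => (Gs k).deriv π x) ⁻¹'
      (Gs k).target δ (fun j => (volume (E j)).toReal) E) ∩
        {x : D | (node Gs).bound δ (fun j => (volume (E j)).toReal) < |(node Gs).deriv π x|}) := by
    ext x
    simp only [exceptional, Set.mem_ofPred_eq, Set.mem_image, Set.mem_inter_iff, Set.mem_iInter,
      Set.mem_preimage, Subtype.exists, exists_and_right, exists_eq_right]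
    tauto
  rw [h]
  refine hD.subtype_image (MeasurableSet.inter (.iInter fun k => ?_)
    (measurableSet_lt measurable_const (hmeas _).abs))
  exact hmeas _ (measurableSet_target δ _ hE (Gs k))

theorem volume_exceptional_le {M U D : Set (Fin d → ℝ)} (hMU : M ⊆ U) (hDM : D ⊆ M)
    (hD : MeasurableSet D) {π : Fin m → (Fin d → ℝ) → ℝ} (hπ : ∀ j, AnalyticOnNhd ℝ (π j) U)
    {δ : ℝ} (hδ : 0 < δ) {E : Fin m → Set ℝ} (hE : ∀ i, MeasurableSet (E i))
    (hE' : ∀ i, volume (E i) ≠ ⊤) {N : ℕ} {Gs : Fin d → DTree d m}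
    (hG : (node Gs).StrongMult M π N) :
    volume (exceptional D π δ E Gs) ≤ ENNReal.ofReal (N * 2 ^ d * δ) := by
  have hDU : D ⊆ U := hDM.trans hMU
  have hb : ∀ G : DTree d m, 0 ≤ G.bound δ (fun j => (volume (E j)).toReal) :=
    bound_nonneg hδ fun j => ENNReal.toReal_nonneg
  have hcont : ∀ G : DTree d m, ContinuousOn (G.deriv π) D := fun G =>
    (analyticOnNhd_deriv hπ G).continuousOn.mono hDU
  refine measure_le_of_lt_abs_det (f := fun x k => (Gs k).deriv π x)
    (f' := fun x => ContinuousLinearMap.pi fun k => fderiv ℝ ((Gs k).deriv π) x) (N := N)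
    (b := (node Gs).bound δ (fun j => (volume (E j)).toReal)) volume
    (measurableSet_exceptional hD hcont δ hE Gs) ?_ ?_ ?_ (hb _) ?_ ?_
  · intro x hx
    exact hasStrictFDerivAt_pi.2 fun k =>
      (analyticOnNhd_deriv hπ (Gs k) x (hDU hx.1)).hasStrictFDerivAt
  · simp only [det_pi_fderiv]
    exact (hcont _).mono fun x hx => hx.1
  · intro c
    refine (Set.encard_le_encard ?_).trans (hG.2 c)
    rintro x ⟨hx, hxc⟩
    exact ⟨hDM hx.1, fun k => congrFun hxc k, abs_pos.1 ((hb _).trans_lt hx.2.2)⟩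
  · intro x hx
    rw [det_pi_fderiv]
    exact hx.2.2
  · have hsub : (fun x k => (Gs k).deriv π x) '' exceptional D π δ E Gs ⊆
        Set.univ.pi fun k => (Gs k).target δ (fun j => (volume (E j)).toReal) E := by
      rintro _ ⟨x, hx, rfl⟩ k -
      exact hx.2.1 k
    calc N * volume ((fun x k => (Gs k).deriv π x) '' exceptional D π δ E Gs)
        ≤ N * ∏ k, volume ((Gs k).target δ (fun j => (volume (E j)).toReal) E) := by
          rw [← volume_pi_pi]
          gcongr
      _ ≤ N * ∏ k, ENNReal.ofReal (2 * (Gs k).bound δ fun j => (volume (E j)).toReal) := by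
          gcongr
          exact volume_target_le δ hE' _
      _ = ENNReal.ofReal ((node Gs).bound δ (fun j => (volume (E j)).toReal) *
            (N * 2 ^ d * δ)) := by
          rw [← ENNReal.ofReal_prod_of_nonneg fun k _ => mul_nonneg zero_le_two (hb _),
            ← ENNReal.ofReal_natCast, ← ENNReal.ofReal_mul (Nat.cast_nonneg N),
            Finset.prod_mul_distrib, ← bound_node_mul hδ]
          congr 1
          simp
          ring

/-- A point of `D` where some derived function of controlled depth leaves its target set lies in
one of the exceptional sets. -/
theorem mem_target_or_mem_exceptional {M D : Set (Fin d → ℝ)} {π : Fin m → (Fin d → ℝ) → ℝ}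
    (δ : ℝ) {E : Fin m → Set ℝ} {N K : ℕ} {x : Fin d → ℝ} (hxD : x ∈ D) (hxE : ∀ i, π i x ∈ E i)
    (G : DTree d m) (hK : G.depth ≤ K) (hG : G.StrongMult M π N) :
    G.deriv π x ∈ G.target δ (fun j => (volume (E j)).toReal) E ∨
      ∃ Gs : Fin d → DTree d m, (node Gs).depth ≤ K ∧ (node Gs).StrongMult M π N ∧
        x ∈ exceptional D π δ E Gs := by
  induction G with
  | leaf i => exact Or.inl (hxE i)
  | node Gs ih =>
    by_contra! h
    obtain ⟨h1, h2⟩ := h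
    refine h2 Gs hK hG ⟨hxD, fun k => ?_, ?_⟩
    · refine (ih k ((depth_child_le Gs k).trans hK) (hG.1 k)).resolve_right ?_
      rintro ⟨Hs, hHK, hH, hx⟩
      exact h2 Hs hHK hH hx
    · exact not_le.1 fun h => h1 (abs_le.1 h)

end DTree

/-- The key localization proposition (Proposition 2 of the paper, Euclidean case):
up to a set of measure `Cδ`, on `E` every derived function `∂^Gπ` for
`G ∈ 𝒢_K^N(M,π)` is bounded by `δ^{-#G} ∏_j |E_j|^{G^{(j)}}`. -/
theorem localization_proposition
    (d m K N : ℕ) :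
    ∃ C : ℝ, ∀ M : Set (Fin d → ℝ), IsCompact M →
      ∀ U : Set (Fin d → ℝ), IsOpen U → M ⊆ U →
      ∀ π : Fin m → (Fin d → ℝ) → ℝ, (∀ j, AnalyticOnNhd ℝ (π j) U) →
      ∀ E : Fin m → Set ℝ, (∀ i, MeasurableSet (E i)) → (∀ i, volume (E i) ≠ ⊤) →
      ∀ D : Set (Fin d → ℝ), IsClosed D → D ⊆ M →
      ∀ δ : ℝ, 0 < δ →
        volume {x ∈ D | ∀ i, π i x ∈ E i} ≤
          ENNReal.ofReal (C * δ) +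
          volume ({x ∈ D | ∀ i, π i x ∈ E i} ∩
            ⋂ G ∈ {G : DTree d m | G.Nontrivial ∧ G.depth ≤ K ∧ G.StrongMult M π N},
              {x ∈ M | |G.deriv π x| ≤
                δ ^ (-(G.count : ℤ)) *
                  ∏ j, (volume (E j)).toReal ^ G.mult j}) := by
  classical
  let T := (DTree.finite_setOf_depth_node_le (d := d) (m := m) K).toFinset
  refine ⟨T.card * (N * 2 ^ d), fun M _ U _ hMU π hπ E hE hE' D hD hDM δ hδ => ?_⟩
  let T' := T.filter fun Gs => (DTree.node Gs).StrongMult M π N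
  have hbad : volume (⋃ Gs ∈ T', DTree.exceptional D π δ E Gs) ≤
      ENNReal.ofReal (T.card * (N * 2 ^ d) * δ) := by
    calc volume (⋃ Gs ∈ T', DTree.exceptional D π δ E Gs)
        ≤ ∑ Gs ∈ T', volume (DTree.exceptional D π δ E Gs) := measure_biUnion_finset_le _ _
      _ ≤ ∑ _Gs ∈ T', ENNReal.ofReal (N * 2 ^ d * δ) := Finset.sum_le_sum fun Gs hGs =>
          DTree.volume_exceptional_le hMU hDM hD.measurableSet hπ hδ hE hE'
            (Finset.mem_filter.1 hGs).2
      _ ≤ T.card * ENNReal.ofReal (N * 2 ^ d * δ) := by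
          rw [Finset.sum_const, nsmul_eq_mul]
          gcongr
          exact Finset.filter_subset _ _
      _ = ENNReal.ofReal (T.card * (N * 2 ^ d) * δ) := by
          rw [mul_assoc (T.card : ℝ), ENNReal.ofReal_mul (Nat.cast_nonneg _), ENNReal.ofReal_natCast]
  refine (measure_mono fun x hx => ?_).trans
    ((measure_union_le (⋃ Gs ∈ T', DTree.exceptional D π δ E Gs) _).trans (by gcongr))
  by_cases hxT : x ∈ ⋃ Gs ∈ T', DTree.exceptional D π δ E Gs
  · exact Or.inl hxT
  refine Or.inr ⟨hx, Set.mem_iInter₂.2 fun G hG => ⟨hDM hx.1, ?_⟩⟩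
  obtain ⟨hnt, hGK, hGN⟩ := hG
  rcases DTree.mem_target_or_mem_exceptional δ hx.1 hx.2 G hGK hGN with h | ⟨Gs, hK, hs, h⟩
  · cases G with
    | leaf i => exact absurd rfl (hnt i)
    | node Gs => exact abs_le.2 h
  · have hGs : Gs ∈ T' := Finset.mem_filter.2
      ⟨(DTree.finite_setOf_depth_node_le K).mem_toFinset.2 hK, hs⟩
    exact absurd (Set.mem_iUnion₂_of_mem hGs h) hxT
end
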